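/- Suppose the characteristic of the field F is not 2 and every element of F is a square. Then every symmetric n×n matrix X over F is B-congruent to a unique sub-permutation (0,1)-matrix; that is, there is exactly one sub-permutation (0,1)-matrix Y such that Y = h'Xh for some h ∈ B. -/

import Mathlib

open Matrix

variable {F : Type*} [Field F] {n : ℕ}

/-- Membership in `B`: invertible upper triangular matrices. -/
def InB (h : Matrix (Fin n) (Fin n) F) : Prop :=
  IsUnit h.det ∧ ∀ i j : Fin n, j < i → h i j = 0

/-- A sub-permutation matrix: at most one nonzero entry in every row and column. -/
def SubPerm (Y : Matrix (Fin n) (Fin n) F) : Prop :=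
  (∀ i j k : Fin n, Y i j ≠ 0 → Y i k ≠ 0 → j = k) ∧
  (∀ i j k : Fin n, Y i k ≠ 0 → Y j k ≠ 0 → i = j)

/-- A (0,1)-matrix: every entry is 0 or 1. -/
def ZeroOne (Y : Matrix (Fin n) (Fin n) F) : Prop :=
  ∀ i j, Y i j = 0 ∨ Y i j = 1

section Congruence

/-- `Y` is obtained from `X` by congruence with an element of `B`. -/
def BCongr (X Y : Matrix (Fin n) (Fin n) F) : Prop :=
  ∃ h : Matrix (Fin n) (Fin n) F, InB h ∧ Y = hᵀ * X * h

theorem InB.one : InB (1 : Matrix (Fin n) (Fin n) F) :=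
  ⟨by simp, fun _ _ hij => Matrix.one_apply_ne hij.ne'⟩

theorem InB.mul {g h : Matrix (Fin n) (Fin n) F} (hg : InB g) (hh : InB h) : InB (g * h) := by
  refine ⟨by rw [det_mul]; exact hg.1.mul hh.1, fun i j hij => ?_⟩
  exact BlockTriangular.mul (b := id) (fun i j => hg.2 i j) (fun i j => hh.2 i j) hij

theorem InB.inv {h : Matrix (Fin n) (Fin n) F} (hh : InB h) : InB h⁻¹ := by
  refine ⟨isUnit_nonsing_inv_det h hh.1, fun i j hij => ?_⟩
  have := h.invertibleOfIsUnitDet hh.1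
  exact blockTriangular_inv_of_blockTriangular (b := id) (fun i j => hh.2 i j) hij

theorem InB.of_diag {h : Matrix (Fin n) (Fin n) F} (h0 : ∀ i j : Fin n, j < i → h i j = 0)
    (h1 : ∀ i, h i i ≠ 0) : InB h := by
  refine ⟨?_, h0⟩
  rw [det_of_isUpperTriangular (fun i j => h0 i j), isUnit_iff_ne_zero]
  exact Finset.prod_ne_zero_iff.2 fun i _ => h1 i

theorem BCongr.refl (X : Matrix (Fin n) (Fin n) F) : BCongr X X := ⟨1, InB.one, by simp⟩

theorem BCongr.trans {X Y Z : Matrix (Fin n) (Fin n) F} (h₁ : BCongr X Y) (h₂ : BCongr Y Z) :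
    BCongr X Z := by
  obtain ⟨g, hg, rfl⟩ := h₁
  obtain ⟨h, hh, rfl⟩ := h₂
  exact ⟨g * h, hg.mul hh, by simp only [transpose_mul, Matrix.mul_assoc]⟩

theorem BCongr.symm {X Y : Matrix (Fin n) (Fin n) F} (h₁ : BCongr X Y) : BCongr Y X := by
  obtain ⟨g, hg, rfl⟩ := h₁
  refine ⟨g⁻¹, hg.inv, ?_⟩
  have h1 : g * g⁻¹ = 1 := mul_nonsing_inv g hg.1
  have h2 : g⁻¹ᵀ * gᵀ = 1 := by rw [← transpose_mul, h1, transpose_one]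
  calc X = (g⁻¹ᵀ * gᵀ) * X * (g * g⁻¹) := by rw [h1, h2, Matrix.one_mul, Matrix.mul_one]
    _ = g⁻¹ᵀ * (gᵀ * X * g) * g⁻¹ := by simp only [Matrix.mul_assoc]

theorem BCongr.isSymm {X Y : Matrix (Fin n) (Fin n) F} (h : BCongr X Y) (hX : X.IsSymm) :
    Y.IsSymm := by
  obtain ⟨g, -, rfl⟩ := h
  simp only [IsSymm, transpose_mul, transpose_transpose, hX.eq, Matrix.mul_assoc]

theorem bCongr_scale (X : Matrix (Fin n) (Fin n) F) (d : Fin n → F) (hd : ∀ i, d i ≠ 0) :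
    BCongr X (of fun k l => d k * X k l * d l) := by
  refine ⟨diagonal d, InB.of_diag (fun i j hij => diagonal_apply_ne _ hij.ne') (by simpa), ?_⟩
  ext k l
  simp

theorem bCongr_shear (X : Matrix (Fin n) (Fin n) F) (i : Fin n) (a : Fin n → F)
    (ha : ∀ k ≤ i, a k = 0) :
    BCongr X (of fun k l => X k l + a k * X i l + X k i * a l + a k * X i i * a l) := by
  refine ⟨1 + vecMulVec (Pi.single i 1) a, InB.of_diag (fun k l hkl => ?_) (fun k => ?_), ?_⟩
  · rw [Matrix.add_apply, one_apply_ne hkl.ne', vecMulVec_apply, zero_add]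
    by_cases hk : k = i
    · subst hk; simp [ha l hkl.le]
    · simp [hk]
  · rw [Matrix.add_apply, one_apply_eq, vecMulVec_apply]
    by_cases hk : k = i
    · subst hk; simp [ha k le_rfl]
    · simp [hk]
  · ext k l
    simp only [transpose_add, transpose_one, transpose_vecMulVec, Matrix.add_mul, Matrix.mul_add,
      Matrix.one_mul, Matrix.mul_one, Matrix.add_apply, of_apply]
    have h1 : (vecMulVec a (Pi.single i 1) * X) = vecMulVec a (X i) := by
      rw [vecMulVec_mul]; simp; rfl
    have h2 : (X * vecMulVec (Pi.single i 1) a) = vecMulVec (fun k => X k i) a := by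
      rw [mul_vecMulVec]; simp; rfl
    rw [h1, h2, vecMulVec_mul_vecMulVec]
    simp [vecMulVec_apply]
    ring

end Congruence

section Existence

/-- The rows of `X` indexed by `S` are zero or standard basis vectors supported in `S`. -/
def Reduced (S : Finset (Fin n)) (X : Matrix (Fin n) (Fin n) F) : Prop :=
  ∀ i ∈ S, (∀ j, X i j = 0 ∨ X i j = 1) ∧ (∀ j k, X i j ≠ 0 → X i k ≠ 0 → j = k) ∧
    ∀ j ∉ S, X i j = 0

theorem Reduced.insert_pair {S : Finset (Fin n)} {X Y : Matrix (Fin n) (Fin n) F} {i j : Fin n} {c : F}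
    (hX : Reduced S X) (hY : ∀ k ∈ S, ∀ l, Y k l = X k l) (hc : c = 0 ∨ c = 1)
    (hi : ∀ l, Y i l = if l = j then c else 0)
    (hj : ∀ l, Y j l = if l = i then c else 0) :
    Reduced (insert i (insert j S)) Y := by
  intro k hk
  simp only [Finset.mem_insert] at hk ⊢
  by_cases hkS : k ∈ S
  · obtain ⟨h1, h2, h3⟩ := hX k hkS
    simp only [hY k hkS]
    exact ⟨h1, h2, fun l hl => h3 l fun h => hl (Or.inr (Or.inr h))⟩
  · rcases hk with rfl | rfl | hk
    · simp only [hi]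
      refine ⟨fun l => ?_, fun l m => ?_, fun l => ?_⟩ <;> grind
    · simp only [hj]
      refine ⟨fun l => ?_, fun l m => ?_, fun l => ?_⟩ <;> grind
    · exact absurd hk hkS

theorem Reduced.exists_step_of_diag {S : Finset (Fin n)} {X : Matrix (Fin n) (Fin n) F}
    (hsq : ∀ a : F, ∃ b : F, b ^ 2 = a) (hX : X.IsSymm) (hS : Reduced S X) {i : Fin n}
    (hiS : i ∉ S) (hlt : ∀ k < i, k ∈ S) (hii : X i i ≠ 0) :
    ∃ Y, BCongr X Y ∧ Reduced (insert i S) Y := by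
  have hs : ∀ k l, X k l = X l k := fun k l => hX.apply l k
  obtain ⟨c, hc⟩ := hsq (X i i)⁻¹
  have hc0 : c ≠ 0 := by rintro rfl; simp [hii, eq_comm] at hc
  have hci : c * X i i * c = 1 := by
    rw [mul_right_comm, ← sq, hc, inv_mul_cancel₀ hii]
  have hSi : ∀ k ∈ S, X k i = 0 := fun k hk => (hS k hk).2.2 i hiS
  set d : Fin n → F := fun k => if k = i then c else 1 with hd
  have hd0 : ∀ k, d k ≠ 0 := fun k => by simp only [hd]; split_ifs <;> simp [hc0]
  set X₁ : Matrix (Fin n) (Fin n) F := of fun k l => d k * X k l * d l with hX₁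
  set a : Fin n → F := fun k => if i < k then - X₁ k i else 0 with ha
  have e1 : X₁ i i = 1 := by simp [hX₁, hd, hci]
  have e2 : ∀ k l, X₁ k l = X₁ l k := fun k l => by simp only [hX₁, of_apply, hs k l]; ring
  have e3 : ∀ k ∈ S, X₁ k i = 0 := fun k hk => by simp [hX₁, hSi k hk]
  have e4 : ∀ k ∈ S, ∀ l, X₁ k l = X k l := fun k hk l => by
    have : k ≠ i := fun h => hiS (h ▸ hk)
    by_cases hl : l = i
    · subst hl; rw [e3 k hk, hSi k hk]
    · simp [hX₁, hd, this, hl]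
  have ha1 : ∀ k, k ≠ i → a k = - X₁ k i := fun k hk => by
    simp only [ha]
    split_ifs with h
    · rfl
    · rw [e3 k (hlt k (lt_of_le_of_ne (not_lt.1 h) hk)), neg_zero]
  have hai : a i = 0 := by simp [ha]
  refine ⟨_, (bCongr_scale X d hd0).trans (bCongr_shear X₁ i a fun k hk => by
    simp [ha, not_lt.2 hk]), ?_⟩
  have hrow : ∀ l, X₁ i l + a i * X₁ i l + X₁ i i * a l + a i * X₁ i i * a l =
      if l = i then 1 else 0 := fun l => by
    by_cases hl : l = i
    · subst hl; simp [hai, e1]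
    · rw [ha1 l hl, hai, e1, e2 l i]; simp [hl]
  have := hS.insert_pair (i := i) (j := i) (c := 1)
    (Y := of fun k l => X₁ k l + a k * X₁ i l + X₁ k i * a l + a k * X₁ i i * a l)
    (fun k hk l => by
      have : k ≠ i := fun h => hiS (h ▸ hk)
      simp [ha1 k this, e3 k hk, e4 k hk]) (Or.inr rfl) hrow hrow
  simpa using this

theorem Reduced.exists_step_of_offDiag {S : Finset (Fin n)} {X : Matrix (Fin n) (Fin n) F}
    (hchar : (2 : F) ≠ 0) (hX : X.IsSymm) (hS : Reduced S X) {i j : Fin n}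
    (hiS : i ∉ S) (hlt : ∀ k < i, k ∈ S) (hii : X i i = 0) (hij : X i j ≠ 0)
    (hj : ∀ k < j, X i k = 0) :
    ∃ Y, BCongr X Y ∧ Reduced (insert i (insert j S)) Y := by
  have hs : ∀ k l, X k l = X l k := fun k l => hX.apply l k
  have hSi : ∀ k ∈ S, X k i = 0 := fun k hk => (hS k hk).2.2 i hiS
  have hjS : j ∉ S := fun h => hij (by rw [hs, hSi j h])
  have hSj : ∀ k ∈ S, X k j = 0 := fun k hk => (hS k hk).2.2 j hjS
  have hne : j ≠ i := by rintro rfl; exact hij hii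
  have hij' : i < j := lt_of_le_of_ne (not_lt.1 fun h => hjS (hlt j h)) hne.symm
  set d : Fin n → F := fun k => if k = j then (X i j)⁻¹ else 1 with hd
  have hd0 : ∀ k, d k ≠ 0 := fun k => by simp only [hd]; split_ifs <;> simp [hij]
  obtain ⟨X₁, h01, hX₁⟩ : ∃ X₁, BCongr X X₁ ∧ ∀ k l, X₁ k l = d k * X k l * d l :=
    ⟨_, bCongr_scale X d hd0, fun _ _ => rfl⟩
  have b1 : ∀ k l, X₁ k l = X₁ l k := fun k l => (h01.isSymm hX).apply l k
  have b2 : X₁ i j = 1 := by simp [hX₁, hd, hne.symm, hij]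
  have b3 : X₁ i i = 0 := by simp [hX₁, hii]
  have b4 : ∀ k < j, X₁ i k = 0 := fun k hk => by simp [hX₁, hj k hk]
  have b5 : ∀ k ∈ S, ∀ l, X₁ k l = X k l := fun k hk l => by
    have : k ≠ j := fun h => hjS (h ▸ hk)
    by_cases hl : l = j
    · subst hl; simp [hX₁, hSj k hk]
    · simp [hX₁, hd, this, hl]
  set a : Fin n → F := fun k => if j < k then - X₁ i k else 0 with ha
  have ha1 : ∀ k, k ≠ j → a k = - X₁ i k := fun k hk => by
    simp only [ha]
    split_ifs with h
    · rfl
    · rw [b4 k (lt_of_le_of_ne (not_lt.1 h) hk), neg_zero]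
  have haj : a j = 0 := by simp [ha]
  obtain ⟨X₂, h12, hX₂⟩ : ∃ X₂, BCongr X₁ X₂ ∧
      ∀ k l, X₂ k l = X₁ k l + a k * X₁ j l + X₁ k j * a l + a k * X₁ j j * a l :=
    ⟨_, bCongr_shear X₁ j a fun k hk => by simp [ha, not_lt.2 hk], fun _ _ => rfl⟩
  have h02 := h01.trans h12
  have c1 : ∀ k l, X₂ k l = X₂ l k := fun k l => (h02.isSymm hX).apply l k
  have c2 : ∀ l, X₂ i l = if l = j then 1 else 0 := fun l => by
    rw [hX₂, ha1 i hne.symm, b3]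
    by_cases hl : l = j
    · subst hl; simp [haj, b2]
    · simp [hl, ha1 l hl, b2]
  have c3 : ∀ k ∈ S, ∀ l, X₂ k l = X k l := fun k hk l => by
    have : k ≠ j := fun h => hjS (h ▸ hk)
    rw [hX₂, ha1 k this, b1 i k, b5 k hk, b5 k hk, b5 k hk, hSi k hk, hSj k hk]; simp
  set b : Fin n → F := fun k => if i < k then (if k = j then - X₂ j j / 2 else - X₂ k j) else 0
    with hb
  have hbj : b j = - X₂ j j / 2 := by simp [hb, hij']
  have hb1 : ∀ k, k ≠ i → k ≠ j → b k = - X₂ k j := fun k hk hkj => by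
    simp only [hb, hkj, if_false]
    split_ifs with h
    · rfl
    · have hkS := hlt k (lt_of_le_of_ne (not_lt.1 h) hk)
      rw [c3 k hkS, hSj k hkS, neg_zero]
  have hbi : b i = 0 := by simp [hb]
  obtain ⟨X₃, h23, hX₃⟩ : ∃ X₃, BCongr X₂ X₃ ∧
      ∀ k l, X₃ k l = X₂ k l + b k * X₂ i l + X₂ k i * b l + b k * X₂ i i * b l :=
    ⟨_, bCongr_shear X₂ i b fun k hk => by simp [hb, not_lt.2 hk], fun _ _ => rfl⟩
  refine ⟨X₃, h02.trans h23, hS.insert_pair (c := 1) (fun k hk l => ?_) (Or.inr rfl)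
    (fun l => ?_) (fun l => ?_)⟩
  · have hki : k ≠ i := fun h => hiS (h ▸ hk)
    have hkj : k ≠ j := fun h => hjS (h ▸ hk)
    rw [hX₃, hb1 k hki hkj, c3 k hk, c3 k hk, c3 k hk, hSi k hk, hSj k hk]; simp
  · rw [hX₃, hbi, c2, c2]; simp [hne.symm]
  · rw [hX₃, c1 j i, c2, c2, c2]
    by_cases hlj : l = j
    · subst hlj
      simp only [hbj, if_true, hne, hne.symm, if_false]
      field_simp
      ring
    · by_cases hli : l = i
      · subst hli; rw [c1, c2]; simp [hbi, hne.symm]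
      · rw [hb1 l hli hlj, c1 l j]; simp [hlj, hli, hne.symm]

theorem Reduced.exists_step {S : Finset (Fin n)} {X : Matrix (Fin n) (Fin n) F}
    (hchar : (2 : F) ≠ 0) (hsq : ∀ a : F, ∃ b : F, b ^ 2 = a) (hX : X.IsSymm)
    (hS : Reduced S X) (hne : S ≠ Finset.univ) :
    ∃ T Y, S ⊂ T ∧ BCongr X Y ∧ Reduced T Y := by
  obtain ⟨i, hiS, hlt⟩ : ∃ i, i ∉ S ∧ ∀ k < i, k ∈ S := by
    have hex : ∃ i, i ∉ S := by
      by_contra! h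
      exact hne (Finset.eq_univ_iff_forall.2 h)
    obtain ⟨i, hi, hmin⟩ := WellFounded.has_min (wellFounded_lt (α := Fin n)) {i | i ∉ S} hex
    exact ⟨i, hi, fun k hk => by_contra fun h => hmin k h hk⟩
  by_cases hii : X i i = 0
  · by_cases hrow : ∀ j, X i j = 0
    · refine ⟨insert i S, X, Finset.ssubset_insert hiS, BCongr.refl X, ?_⟩
      have := hS.insert_pair (i := i) (j := i) (c := 0) (fun _ _ _ => rfl) (Or.inl rfl)
        (by simpa using hrow) (by simpa using hrow)
      simpa using this
    · push Not at hrow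
      obtain ⟨j, hj, hmin⟩ := WellFounded.has_min (wellFounded_lt (α := Fin n))
        {j | X i j ≠ 0} hrow
      obtain ⟨Y, h1, h2⟩ := hS.exists_step_of_offDiag hchar hX hiS hlt hii hj
        (fun k hk => by_contra fun h => hmin k h hk)
      refine ⟨_, Y, ?_, h1, h2⟩
      rw [Finset.insert_comm]
      exact (Finset.ssubset_insert hiS).trans_subset
        (by rw [Finset.insert_comm]; exact Finset.insert_subset_insert _ (Finset.subset_insert _ _))
  · obtain ⟨Y, h1, h2⟩ := hS.exists_step_of_diag hsq hX hiS hlt hii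
    exact ⟨_, Y, Finset.ssubset_insert hiS, h1, h2⟩

theorem Reduced.exists_bCongr_univ {S : Finset (Fin n)} {X : Matrix (Fin n) (Fin n) F}
    (hchar : (2 : F) ≠ 0) (hsq : ∀ a : F, ∃ b : F, b ^ 2 = a) (hX : X.IsSymm)
    (hS : Reduced S X) : ∃ Y, BCongr X Y ∧ Reduced Finset.univ Y := by
  induction S using WellFoundedGT.induction generalizing X with
  | ind S ih =>
    by_cases hne : S = Finset.univ
    · exact ⟨X, BCongr.refl X, hne ▸ hS⟩
    · obtain ⟨T, Y, hST, hXY, hT⟩ := hS.exists_step hchar hsq hX hne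
      obtain ⟨Z, hYZ, hZ⟩ := ih T hST (hXY.isSymm hX) hT
      exact ⟨Z, hXY.trans hYZ, hZ⟩

end Existence

section Uniqueness

/-- The matrix agreeing with `X` on the leading block of rows `≤ i` and columns `≤ j`, and zero
elsewhere. -/
def leadingBlock (i j : Fin n) (X : Matrix (Fin n) (Fin n) F) : Matrix (Fin n) (Fin n) F :=
  of fun k l => if k ≤ i ∧ l ≤ j then X k l else 0

theorem BCongr.rank_leadingBlock_le {X Y : Matrix (Fin n) (Fin n) F} (h : BCongr X Y)
    (i j : Fin n) : (leadingBlock i j Y).rank ≤ (leadingBlock i j X).rank := by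
  obtain ⟨g, hg, rfl⟩ := h
  set p : Fin n → Matrix (Fin n) (Fin n) F := fun i => diagonal fun k => if k ≤ i then 1 else 0
    with hp
  have hblock : ∀ Z, leadingBlock i j Z = p i * Z * p j := fun Z => by
    ext k l
    simp only [leadingBlock, hp, of_apply, mul_diagonal, diagonal_mul]
    split_ifs <;> simp_all
  have hright : g * p j = p j * (g * p j) := by
    ext k l
    simp only [hp, mul_diagonal, diagonal_mul]
    by_cases hl : l ≤ j
    · by_cases hk : k ≤ j
      · simp [hk]
      · simp [hk, hg.2 k l (lt_of_le_of_lt hl (not_le.1 hk))]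
    · simp [hl]
  have hleft : p i * gᵀ = p i * gᵀ * p i := by
    ext k l
    simp only [hp, mul_diagonal, diagonal_mul, transpose_apply]
    by_cases hk : k ≤ i
    · by_cases hl : l ≤ i
      · simp [hl]
      · simp [hl, hg.2 l k (lt_of_le_of_lt hk (not_le.1 hl))]
    · simp [hk]
  have heq : leadingBlock i j (gᵀ * X * g) = p i * gᵀ * leadingBlock i j X * (g * p j) := by
    rw [hblock, hblock]
    calc p i * (gᵀ * X * g) * p j = (p i * gᵀ) * X * (g * p j) := by
          simp only [Matrix.mul_assoc]
      _ = (p i * gᵀ * p i) * X * (p j * (g * p j)) := by rw [← hleft, ← hright]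
      _ = _ := by simp only [Matrix.mul_assoc]
  rw [heq]
  exact (rank_mul_le_left _ _).trans (rank_mul_le_right _ _)

theorem rank_lt_rank_add_single {Z : Matrix (Fin n) (Fin n) F} {i j : Fin n}
    (hrow : ∀ l, Z i l = 0) (hcol : ∀ k, Z k j = 0) :
    Z.rank < (Z + single i j 1).rank := by
  have hE : ∀ v : Fin n → F, (Z + single i j 1) *ᵥ v = Z *ᵥ v + Pi.single i (v j) := fun v => by
    ext k
    simp only [mulVec, dotProduct, Matrix.add_apply, add_mul, Finset.sum_add_distrib, Pi.add_apply,
      single_apply]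
    by_cases hk : k = i
    · subst hk; simp
    · simp [hk, Ne.symm hk]
  refine Submodule.finrank_lt_finrank_of_lt (lt_of_le_of_ne ?_ ?_)
  · rintro _ ⟨v, rfl⟩
    refine ⟨Function.update v j 0, ?_⟩
    simp only [mulVecLin_apply]
    rw [hE]
    ext k
    simp only [Function.update_self, Pi.single_zero, add_zero, mulVec, dotProduct]
    refine Finset.sum_congr rfl fun l _ => ?_
    by_cases hl : l = j
    · subst hl; simp [hcol]
    · simp [hl]
  · intro h
    have hmem : (Pi.single i 1 : Fin n → F) ∈ LinearMap.range (Z + single i j 1).mulVecLin := by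
      refine ⟨Pi.single j 1, ?_⟩
      rw [mulVecLin_apply, hE]
      ext k
      simp [hcol]
    rw [← h] at hmem
    obtain ⟨v, hv⟩ := hmem
    have := congrFun hv i
    simp [mulVec, dotProduct, hrow] at this

theorem SubPerm.leadingBlock_rank_lt {Y Z : Matrix (Fin n) (Fin n) F} (hY : SubPerm Y)
    {i j : Fin n} (hlt : ∀ k ≤ i, ∀ l ≤ j, (k, l) ≠ (i, j) → Y k l = Z k l)
    (hYij : Y i j = 1) (hZij : Z i j = 0) :
    (leadingBlock i j Z).rank < (leadingBlock i j Y).rank := by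
  have h1 : Y i j ≠ 0 := by simp [hYij]
  have hadd : leadingBlock i j Y = leadingBlock i j Z + single i j 1 := by
    ext k l
    simp only [leadingBlock, of_apply, Matrix.add_apply, single_apply]
    by_cases hkl : (k, l) = (i, j)
    · obtain ⟨rfl, rfl⟩ := Prod.mk.inj hkl
      simp [hYij, hZij]
    · have : ¬ (i = k ∧ j = l) := fun h => hkl (by rw [h.1, h.2])
      rw [if_neg this, add_zero]
      split_ifs with h
      · exact hlt k h.1 l h.2 hkl
      · rfl
  rw [hadd]
  refine rank_lt_rank_add_single (fun l => ?_) (fun k => ?_)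
  · simp only [leadingBlock, of_apply]
    split_ifs with h
    · by_cases hl : l = j
      · rw [hl, hZij]
      · rw [← hlt i le_rfl l h.2 (by simp [hl])]
        exact by_contra fun h0 => hl (hY.1 i l j h0 h1)
    · rfl
  · simp only [leadingBlock, of_apply]
    split_ifs with h
    · by_cases hk : k = i
      · rw [hk, hZij]
      · rw [← hlt k h.1 j le_rfl (by simp [hk])]
        exact by_contra fun h0 => hk (hY.2 k i j h0 h1)
    · rfl

theorem BCongr.eq_of_subPerm_of_zeroOne {Y Z : Matrix (Fin n) (Fin n) F} (h : BCongr Y Z)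
    (hY : SubPerm Y) (hY' : ZeroOne Y) (hZ : SubPerm Z) (hZ' : ZeroOne Z) : Y = Z := by
  suffices ∀ x : Fin n × Fin n, Y x.1 x.2 = Z x.1 x.2 from ext fun i j => this (i, j)
  intro x
  induction x using WellFoundedLT.induction with
  | ind x ih =>
    obtain ⟨i, j⟩ := x
    have hlt : ∀ k ≤ i, ∀ l ≤ j, (k, l) ≠ (i, j) → Y k l = Z k l := fun k hk l hl hne =>
      ih (k, l) (lt_of_le_of_ne ⟨hk, hl⟩ hne)
    rcases hY' i j with h1 | h1 <;> rcases hZ' i j with h2 | h2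
    · rw [h1, h2]
    · exact absurd (hZ.leadingBlock_rank_lt (fun k hk l hl hne => (hlt k hk l hl hne).symm) h2 h1)
        (h.rank_leadingBlock_le i j).not_gt
    · exact absurd (hY.leadingBlock_rank_lt hlt h1 h2) (h.symm.rank_leadingBlock_le i j).not_gt
    · rw [h1, h2]

end Uniqueness

/-- If `char F ≠ 2` and every element of `F` is a square, every symmetric matrix is
`B`-congruent to a unique sub-permutation (0,1)-matrix. -/
theorem symm_unique_subperm_zeroOne_B_congruent (hn : 2 ≤ n) (hchar : (2 : F) ≠ 0)
    (hsq : ∀ a : F, ∃ b : F, b ^ 2 = a)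
    (X : Matrix (Fin n) (Fin n) F) (hX : X.IsSymm) :
    ∃! Y : Matrix (Fin n) (Fin n) F, (SubPerm Y ∧ ZeroOne Y) ∧
      ∃ h : Matrix (Fin n) (Fin n) F, InB h ∧ Y = hᵀ * X * h := by
  obtain ⟨Y, hXY, hY⟩ := Reduced.exists_bCongr_univ (S := ∅) hchar hsq hX (by simp [Reduced])
  have hs : ∀ k l, Y k l = Y l k := fun k l => (hXY.isSymm hX).apply l k
  refine ⟨Y, ⟨⟨⟨fun i => (hY i (Finset.mem_univ i)).2.1, fun i j k hi hj => ?_⟩,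
    fun i => (hY i (Finset.mem_univ i)).1⟩, hXY⟩, ?_⟩
  · rw [hs] at hi hj
    exact (hY k (Finset.mem_univ k)).2.1 i j hi hj
  · rintro Z ⟨⟨hZ, hZ'⟩, hXZ⟩
    refine BCongr.eq_of_subPerm_of_zeroOne ((BCongr.symm hXZ).trans hXY) hZ hZ'
      ⟨fun i => (hY i (Finset.mem_univ i)).2.1, fun i j k hi hj => ?_⟩
      fun i => (hY i (Finset.mem_univ i)).1
    rw [hs] at hi hj
    exact (hY k (Finset.mem_univ k)).2.1 i j hi hj
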